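/- The set p e (i.e., fun y => p e y) is inductive: ind (p e) holds. -/

import Mathlib

def ind {i : Type*} (e : i) (s : i → i) (X : i → Prop) : Prop :=
  X e ∧ ∀ x, X x → X (s x)

def p {i : Type*} (e : i) (s : i → i) (f : i → i → i) (x y : i) : Prop :=
  ∀ X : i → Prop, ind e s X → X (f x y)

def N {i : Type*} (e : i) (s : i → i) (z : i) : Prop :=
  ∀ X : i → Prop, ind e s X → X z

def pN {i : Type*} (e : i) (s : i → i) (f : i → i → i) (x y : i) : Prop :=
  N e s (f x y)

theorem stmt2 {i : Type*} (e : i) (s : i → i) (f : i → i → i)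
    (A1 : ∀ n, f n e = s e) (A2 : ∀ y, f e (s y) = s (s (f e y))) :
    ind e s (p e s f e) := by
  refine ⟨fun X hX => ?_, fun y hy X hX => ?_⟩
  · rw [A1]
    exact hX.2 _ hX.1
  · rw [A2]
    exact hX.2 _ (hX.2 _ (hy X hX))
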